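/- There do not exist integers x, y such that 6x² − 4xy − 24y² = −2. -/

import Mathlib

/-- Descent along the unit `6 + √37` (of norm `-1`): `u² - 37 y² = ±3` has no solutions. -/
theorem descent_aux (n : ℕ) : ∀ u y : ℤ, 0 ≤ u → 0 ≤ y → y.toNat = n →
    ¬ (u ^ 2 - 37 * y ^ 2 = 3 ∨ u ^ 2 - 37 * y ^ 2 = -3) := by
  induction n using Nat.strong_induction_on with
  | _ n ih =>
    intro u y hu hy hn h
    have hy2 : 2 ≤ y := by
      by_contra hlt
      have h7 : u < 7 := by
        have : y ≤ 1 := by omega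
        rcases h with h | h <;> nlinarith
      have : y ≤ 1 := by omega
      interval_cases y <;> interval_cases u <;> omega
    have h1 : 6 * y ≤ u := by rcases h with h | h <;> nlinarith
    have h2 : u < 7 * y := by rcases h with h | h <;> nlinarith
    have h3 : 0 ≤ 37 * y - 6 * u := by
      by_contra hc
      have hc' : 37 * y < 6 * u := by omega
      rcases h with h | h <;> nlinarith
    refine ih (u - 6 * y).toNat (by omega) (37 * y - 6 * u) (u - 6 * y) h3 (by omega) rfl ?_
    rcases h with h | h
    · right; linarith
    · left; linarith

/-- There do not exist integers `x`, `y` such that `6x² − 4xy − 24y² = −2`. -/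
theorem stmt_12 : ¬ ∃ x y : ℤ, 6 * x ^ 2 - 4 * x * y - 24 * y ^ 2 = -2 := by
  rintro ⟨x, y, h⟩
  refine descent_aux _ |3 * x - y| |y| (abs_nonneg _) (abs_nonneg _) rfl (Or.inr ?_)
  rw [sq_abs, sq_abs]
  linarith
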